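/- Let M be a small Λ-module. Then Ext^{r+1}_Λ(M,Λ) is a module of finite cardinality, isomorphic as an O-module (in particular as an abelian group) to the Pontryagin dual Hom_ℤ(M_fin, ℚ/ℤ) of the maximal finite submodule M_fin of M. In particular, Ext^{r+1}_Λ(M,Λ) and M_fin have the same cardinality. -/

import Mathlib

open CategoryTheory Opposite

set_option maxHeartbeats 1000000
set_option synthInstance.maxHeartbeats 400000

noncomputable section

/-- The valuation ring of a finite extension `K` of `ℚ_p`, realized as the integral
closure of `ℤ_p` in `K`. -/
abbrev PadicValRing (p : ℕ) [Fact p.Prime] (K : Type) [Field K] [Algebra ℚ_[p] K]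
    [Algebra ℤ_[p] K] [IsScalarTower ℤ_[p] ℚ_[p] K] : Type :=
  integralClosure ℤ_[p] K

/-- The formal power series ring `Λ = O⟦t₁, …, t_r⟧` over the valuation ring `O`. -/
abbrev IwasawaAlgebra (p : ℕ) [Fact p.Prime] (K : Type) [Field K] [Algebra ℚ_[p] K]
    [Algebra ℤ_[p] K] [IsScalarTower ℤ_[p] ℚ_[p] K] (r : ℕ) : Type :=
  MvPowerSeries (Fin r) (PadicValRing p K)

/-- `Ext^i_R(M, N)`, as a type (carrying its natural `R`-module structure). -/
abbrev ExtGroup (R : Type) [CommRing R] (i : ℕ) (M N : Type) [AddCommGroup M] [Module R M]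
    [AddCommGroup N] [Module R N] : Type :=
  ((Ext R (ModuleCat R) i).obj (op (ModuleCat.of R M))).obj (ModuleCat.of R N)

/-- The height of an ideal: the infimum of the heights of the prime ideals containing it. -/
noncomputable def idealHeight {R : Type} [CommRing R] (I : Ideal R) : ℕ∞ :=
  ⨅ P : {P : PrimeSpectrum R // I ≤ P.asIdeal}, Order.height P.1

/-- The maximal finite submodule `M_fin` of `M`: the supremum of all submodules of
finite cardinality (for a Noetherian module over a ring with finite residue field this
supremum is itself finite). -/
noncomputable def finPart (R M : Type) [CommRing R] [AddCommGroup M] [Module R M] :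
    Submodule R M :=
  sSup {N : Submodule R M | Set.Finite (N : Set M)}

section Comparison

variable {R : Type} [CommRing R]

theorem extMk_smul' {X Y : ModuleCat.{0} R} (P : ProjectiveResolution X) {n : ℕ}
    (f : P.complex.X n ⟶ Y) (m : ℕ) (hm : n + 1 = m) (hf : P.complex.d m n ≫ f = 0) (a : R) :
    a • P.extMk f m hm hf = P.extMk (a • f) m hm (by simp [hf]) := by
  rw [Abelian.Ext.smul_eq_comp_mk₀, P.extMk_comp_mk₀]
  congr 1

/-- the linear map from cocycles to `Ext`. -/
def cocyclesToExt {X Y : ModuleCat.{0} R} (P : ProjectiveResolution X) (n : ℕ) :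
    LinearMap.ker ((P.complex.linearYonedaObj R Y).d n (n + 1)).hom →ₗ[R] Abelian.Ext X Y n where
  toFun f := P.extMk (f.1 : P.complex.X n ⟶ Y) (n + 1) rfl f.2
  map_add' f g := (P.add_extMk _ _ _ _ _ _).symm
  map_smul' a f := (extMk_smul' P _ _ _ _ a).symm

theorem extComparison (X Y : ModuleCat.{0} R) (n : ℕ) :
    Nonempty ((((Ext R (ModuleCat.{0} R) (n + 1)).obj (op X)).obj Y) ≃ₗ[R] Abelian.Ext X Y (n + 1)) := by
  let P : ProjectiveResolution X := (HasProjectiveResolution.out (Z := X)).some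
  let C := P.complex.linearYonedaObj R Y
  let S := C.sc' n (n + 1) (n + 2)
  have e1 := (P.isoExt (R := R) (n + 1) Y).toLinearEquiv
  have e2 : C.homology (n + 1) ≃ₗ[R] S.homology :=
    (ShortComplex.homologyMapIso (C.isoSc' n (n+1) (n+2) (by simp) (by simp))).toLinearEquiv
  have e3 := S.moduleCatHomologyIso.toLinearEquiv
  refine ⟨e1 ≪≫ₗ e2 ≪≫ₗ e3 ≪≫ₗ ?_⟩
  let φ : LinearMap.ker S.g.hom →ₗ[R] Abelian.Ext X Y (n + 1) := cocyclesToExt (Y := Y) P (n + 1)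
  have hφ : Function.Surjective φ := by
    intro α
    obtain ⟨f, hf, h⟩ := P.extMk_surjective α (n + 2) rfl
    exact ⟨⟨f, hf⟩, h⟩
  have hk : LinearMap.ker φ = LinearMap.range S.moduleCatToCycles := by
    ext f
    refine (P.extMk_eq_zero_iff (f.1 : P.complex.X (n + 1) ⟶ Y) (n + 2) rfl f.2 n rfl).trans ?_
    constructor
    · rintro ⟨g, hg⟩
      exact ⟨g, Subtype.ext hg⟩
    · rintro ⟨g, hg⟩
      exact ⟨g, congrArg Subtype.val hg⟩
  exact (Submodule.quotEquivOfEq _ _ hk.symm) ≪≫ₗ φ.quotKerEquivOfSurjective hφ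

end Comparison
section ExtLemmas

open scoped Pointwise

variable {R : Type} [CommRing R]

/-- the quotient short complex `N → M → M / N` -/
abbrev quotSC {M : Type} [AddCommGroup M] [Module R M] (N : Submodule R M) :
    ShortComplex (ModuleCat.{0} R) :=
  ModuleCat.shortComplexOfCompEqZero N.subtype N.mkQ
    (LinearMap.exact_subtype_mkQ N).linearMap_comp_eq_zero

theorem quotSC_shortExact {M : Type} [AddCommGroup M] [Module R M] (N : Submodule R M) :
    (quotSC N).ShortExact where
  exact := ModuleCat.shortComplex_exact _ (LinearMap.exact_subtype_mkQ N)
  mono_f := by simp [ModuleCat.mono_iff_injective]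
  epi_g := by simpa [ModuleCat.epi_iff_surjective] using Submodule.mkQ_surjective _

theorem ext_eq_zero_of_regular [IsLocalRing R] [IsNoetherianRing R] (M L : ModuleCat.{0} R)
    [Module.Finite R M] [Module.Finite R L] (x : R) (reg : IsSMulRegular M x)
    (mem : x ∈ IsLocalRing.maximalIdeal R) (i : ℕ)
    (h : Subsingleton (Abelian.Ext (ModuleCat.of R (QuotSMulTop x M)) L (i + 1))) :
    Subsingleton (Abelian.Ext M L i) := by
  have hS := reg.smulShortComplex_shortExact
  by_contra ntr
  rw [not_subsingleton_iff_nontrivial] at ntr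
  have hx : x ∈ (Module.annihilator R (Abelian.Ext M L i)).jacobson :=
    (IsLocalRing.maximalIdeal_le_jacobson _) mem
  apply Submodule.top_ne_pointwise_smul_of_mem_jacobson_annihilator hx
  rw [eq_comm, eq_top_iff]
  intro y hy
  obtain ⟨z, hz⟩ := Abelian.Ext.contravariant_sequence_exact₁ hS L y (add_comm 1 i)
    (@Subsingleton.elim _ h _ _)
  replace hz : (Abelian.Ext.mk₀ (x • 𝟙 M)).comp (show Abelian.Ext M L i from z) (zero_add i) = y := hz
  rw [Abelian.Ext.mk₀_smul, Abelian.Ext.smul_comp,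
    Abelian.Ext.mk₀_id_comp] at hz
  rw [← hz]
  exact Submodule.smul_mem_pointwise_smul _ _ ⊤ trivial

theorem subsingleton_ext_of_residue [IsLocalRing R] [IsNoetherianRing R] (L : ModuleCat.{0} R)
    [Module.Finite R L] (n : ℕ)
    (h : ∀ i, n < i → Subsingleton (Abelian.Ext
      (ModuleCat.of R (R ⧸ IsLocalRing.maximalIdeal R)) L i))
    (M : Type) [AddCommGroup M] [Module R M] [Module.Finite R M] (i : ℕ) (hi : n < i) :
    Subsingleton (Abelian.Ext (ModuleCat.of R M) L i) := by
  suffices H : ∀ N : Submodule R M, ∀ (M' : Type) [AddCommGroup M'] [Module R M']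
      (f : M →ₗ[R] M'), Function.Surjective f → LinearMap.ker f = N → ∀ i, n < i →
      Subsingleton (Abelian.Ext (ModuleCat.of R M') L i) from
    H _ M LinearMap.id Function.surjective_id rfl i hi
  intro N
  induction N using (wellFounded_gt (α := Submodule R M)).induction with
  | h N ih =>
  intro M' _ _ f hf hker i hi
  have : Module.Finite R M' := Module.Finite.of_surjective f hf
  have ih' : ∀ Q : Submodule R M', Q ≠ ⊥ → ∀ i, n < i →
      Subsingleton (Abelian.Ext (ModuleCat.of R (M' ⧸ Q)) L i) := by
    intro Q hQ
    refine ih (LinearMap.ker (Q.mkQ ∘ₗ f)) ?_ (M' ⧸ Q) (Q.mkQ ∘ₗ f)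
      ((Submodule.mkQ_surjective Q).comp hf) rfl
    rw [← hker]
    refine lt_of_le_of_ne (LinearMap.ker_le_ker_comp f Q.mkQ) ?_
    intro heq
    apply hQ
    rw [eq_bot_iff]
    intro y hy
    obtain ⟨m, rfl⟩ := hf y
    have : m ∈ LinearMap.ker (Q.mkQ ∘ₗ f) := by simpa using hy
    rw [← heq] at this
    simpa using this
  by_cases hs : Subsingleton (R ⧸ IsLocalRing.maximalIdeal R →ₗ[R] M')
  · obtain ⟨x, hx, reg⟩ := IsSMulRegular.subsingleton_linearMap_iff.mp hs
    rw [Ideal.annihilator_quotient] at hx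
    cases subsingleton_or_nontrivial M' with
    | inl hM =>
      have hz : Limits.IsZero (ModuleCat.of R M') := ModuleCat.isZero_of_subsingleton _
      refine ⟨fun a b => ?_⟩
      have : ∀ a : Abelian.Ext (ModuleCat.of R M') L i, a = 0 := fun a => by
        rw [← Abelian.Ext.mk₀_id_comp a, hz.eq_of_src (𝟙 _) 0]
        simp
      rw [this a, this b]
    | inr hM =>
      refine ext_eq_zero_of_regular (ModuleCat.of R M') L x reg hx i (ih' _ ?_ (i + 1) (by omega))
      intro hb
      obtain ⟨y, hy⟩ := exists_ne (0 : M')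
      apply hy
      apply reg
      have : x • y ∈ (x • (⊤ : Submodule R M')) := Submodule.smul_mem_pointwise_smul _ _ ⊤ trivial
      rw [hb] at this
      simpa using this
  · rw [not_subsingleton_iff_nontrivial] at hs
    obtain ⟨g, hg⟩ := exists_ne (0 : R ⧸ IsLocalRing.maximalIdeal R →ₗ[R] M')
    have : IsSimpleModule R (R ⧸ IsLocalRing.maximalIdeal R) :=
      isSimpleModule_iff_isCoatom.mpr (IsLocalRing.maximalIdeal.isMaximal R).out
    have hinj : Function.Injective g := (LinearMap.injective_or_eq_zero g).resolve_right hg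
    let Q := LinearMap.range g
    have hQ : Q ≠ ⊥ := fun h => hg (LinearMap.range_eq_bot.mp h)
    have e : (ModuleCat.of R (R ⧸ IsLocalRing.maximalIdeal R)) ≅ ModuleCat.of R Q :=
      (LinearEquiv.ofInjective g hinj).toModuleIso
    have h1 : ∀ a : Abelian.Ext (ModuleCat.of R Q) L i, a = 0 := by
      intro a
      have : (Abelian.Ext.mk₀ e.inv).comp ((Abelian.Ext.mk₀ e.hom).comp a (zero_add i)) (zero_add i) = a := by
        rw [Abelian.Ext.mk₀_comp_mk₀_assoc, e.inv_hom_id, Abelian.Ext.mk₀_id_comp]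
      rw [← this, @Subsingleton.elim _ (h i hi) ((Abelian.Ext.mk₀ e.hom).comp a (zero_add i)) 0]
      simp
    have h2 : ∀ a : Abelian.Ext (ModuleCat.of R M') L i, a = 0 := by
      intro a
      obtain ⟨b, hb⟩ := Abelian.Ext.contravariant_sequence_exact₂ (quotSC_shortExact Q) L a (h1 _)
      rw [← hb, @Subsingleton.elim _ (ih' Q hQ i hi) b 0]
      simp
    exact ⟨fun a b => by rw [h2 a, h2 b]⟩

/-- reduction to the maximal submodule of finite length -/
theorem ext_equiv_sub [IsLocalRing R] [IsNoetherianRing R] (L : ModuleCat.{0} R)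
    [Module.Finite R L] (n : ℕ)
    (h : ∀ i, n < i → Subsingleton (Abelian.Ext
      (ModuleCat.of R (R ⧸ IsLocalRing.maximalIdeal R)) L i))
    (M : Type) [AddCommGroup M] [Module R M] [Module.Finite R M] (N : Submodule R M)
    (hN : Subsingleton (R ⧸ IsLocalRing.maximalIdeal R →ₗ[R] M ⧸ N)) :
    Nonempty (Abelian.Ext (ModuleCat.of R M) L n ≃ₗ[R] Abelian.Ext (ModuleCat.of R N) L n) := by
  obtain ⟨x, hx, reg⟩ := IsSMulRegular.subsingleton_linearMap_iff.mp hN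
  rw [Ideal.annihilator_quotient] at hx
  have h0 : Subsingleton (Abelian.Ext (ModuleCat.of R (M ⧸ N)) L n) :=
    ext_eq_zero_of_regular (ModuleCat.of R (M ⧸ N)) L x reg hx n
      (subsingleton_ext_of_residue L n h _ (n + 1) (by omega))
  have h1 : Subsingleton (Abelian.Ext (ModuleCat.of R (M ⧸ N)) L (n + 1)) :=
    subsingleton_ext_of_residue L n h _ (n + 1) (by omega)
  have hS := quotSC_shortExact N
  refine ⟨LinearEquiv.ofBijective ((Abelian.Ext.mk₀ (quotSC N).f).precompOfLinear R L (zero_add n))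
    ⟨?_, ?_⟩⟩
  · rw [injective_iff_map_eq_zero]
    intro a ha
    obtain ⟨b, hb⟩ := Abelian.Ext.contravariant_sequence_exact₂ hS L a ha
    rw [← hb, @Subsingleton.elim _ h0 b 0]
    simp
  · intro a
    exact Abelian.Ext.contravariant_sequence_exact₁ hS L a (add_comm 1 n) (@Subsingleton.elim _ h1 _ _)

/-- Rees' lemma -/
theorem rees (F : Type) [AddCommGroup F] [Module R F] (rs : List R) :
    ∀ (N : Type) [AddCommGroup N] [Module R N], RingTheory.Sequence.IsWeaklyRegular N rs →
    (∀ x ∈ rs, ∀ y : F, x • y = 0) →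
    (∀ i, i < rs.length → Subsingleton (Abelian.Ext (ModuleCat.of R F) (ModuleCat.of R N) i)) ∧
    Nonempty (Abelian.Ext (ModuleCat.of R F) (ModuleCat.of R N) rs.length ≃ₗ[R]
      (F →ₗ[R] (N ⧸ (Ideal.ofList rs • ⊤ : Submodule R N)))) := by
  induction rs with
  | nil =>
    intro N _ _ _ _
    refine ⟨by simp, ⟨Abelian.Ext.linearEquiv₀ ≪≫ₗ ModuleCat.homLinearEquiv ≪≫ₗ
      LinearEquiv.congrRight (Submodule.quotEquivOfEqBot _ (by simp)).symm⟩⟩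
  | cons x rs ih =>
    intro N _ _ hreg hann
    rw [RingTheory.Sequence.isWeaklyRegular_cons_iff] at hreg
    obtain ⟨h1, ⟨h2⟩⟩ := ih (QuotSMulTop x N) hreg.2 (fun y hy => hann y (by simp [hy]))
    have hS := IsSMulRegular.smulShortComplex_shortExact (M := ModuleCat.of R N) hreg.1
    have hx : ∀ i (a : Abelian.Ext (ModuleCat.of R F) (ModuleCat.of R N) i), x • a = 0 := by
      intro i a
      have : x • (𝟙 (ModuleCat.of R F)) = 0 := by
        ext y
        exact hann x (by simp) y
      rw [← Abelian.Ext.mk₀_id_comp a, ← Abelian.Ext.smul_comp, ← Abelian.Ext.mk₀_smul, this]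
      simp
    have hf : ∀ i (a : Abelian.Ext (ModuleCat.of R F) (ModuleCat.of R N) i),
        a.comp (Abelian.Ext.mk₀ ((ModuleCat.of R N).smulShortComplex x).f) (add_zero i) = 0 := by
      intro i a
      rw [ModuleCat.smulShortComplex_f_eq_smul_id]
      exact (Abelian.Ext.smul_eq_comp_mk₀ a x).symm.trans (hx i a)
    have hsub : ∀ i, i < rs.length + 1 →
        Subsingleton (Abelian.Ext (ModuleCat.of R F) (ModuleCat.of R N) i) := by
      intro i hi
      suffices h : ∀ a : Abelian.Ext (ModuleCat.of R F) (ModuleCat.of R N) i, a = 0 from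
        ⟨fun a b => by rw [h a, h b]⟩
      intro a
      cases i with
      | zero =>
        have := hS.mono_f
        apply Abelian.Ext.postcomp_mk₀_injective_of_mono (ModuleCat.of R F)
          ((ModuleCat.of R N).smulShortComplex x).f
        exact (hf 0 a).trans (map_zero ((Abelian.Ext.mk₀
          ((ModuleCat.of R N).smulShortComplex x).f).postcomp (ModuleCat.of R F) (add_zero 0))).symm
      | succ i =>
        obtain ⟨b, hb⟩ := Abelian.Ext.covariant_sequence_exact₁ (ModuleCat.of R F) hS a (hf _ a) rfl
        rw [← hb, @Subsingleton.elim _ (h1 i (by omega)) b 0]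
        exact Abelian.Ext.zero_comp ..
    refine ⟨hsub, ⟨?_⟩⟩
    have hbij : Function.Bijective
        (hS.extClass.postcompOfLinear R (ModuleCat.of R F) (a := rs.length) rfl) := by
      constructor
      · rw [injective_iff_map_eq_zero]
        intro a ha
        obtain ⟨b, hb⟩ := Abelian.Ext.covariant_sequence_exact₃ (ModuleCat.of R F) hS a rfl ha
        rw [← hb, @Subsingleton.elim _ (hsub rs.length (by omega)) b 0]
        exact Abelian.Ext.zero_comp ..
      · intro a
        exact Abelian.Ext.covariant_sequence_exact₁ (ModuleCat.of R F) hS a (hf _ a) rfl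
    exact (LinearEquiv.ofBijective _ hbij).symm ≪≫ₗ h2 ≪≫ₗ LinearEquiv.congrRight
      (Submodule.quotOfListConsSMulTopEquivQuotSMulTopInner N x rs).symm

end ExtLemmas
section Duality

/-- the embedding of `ℚ/ℤ` into `ℂ` as an additive character -/
theorem exists_addChar_injective :
    ∃ c : AddChar (AddCircle (1 : ℚ)) ℂ, Function.Injective c := by
  let f : AddCircle (1 : ℚ) →+ AddCircle (1 : ℝ) :=
    QuotientAddGroup.map (AddSubgroup.zmultiples (1 : ℚ)) (AddSubgroup.zmultiples (1 : ℝ))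
      (Rat.castHom ℝ).toAddMonoidHom (by
        intro x hx
        obtain ⟨n, rfl⟩ := AddSubgroup.mem_zmultiples_iff.mp hx
        exact AddSubgroup.mem_zmultiples_iff.mpr ⟨n, by simp⟩)
  have hf : Function.Injective f := by
    rw [injective_iff_map_eq_zero]
    intro a
    induction a using QuotientAddGroup.induction_on with
    | H z =>
      intro h
      have h' : ((z : ℝ) : AddCircle (1 : ℝ)) = 0 := h
      rw [AddCircle.coe_eq_zero_iff] at h'
      obtain ⟨n, hn⟩ := h'
      refine (AddCircle.coe_eq_zero_iff (1 : ℚ)).mpr ⟨n, ?_⟩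
      have : ((n • (1 : ℚ) : ℚ) : ℝ) = (z : ℝ) := by simpa using hn
      exact_mod_cast this
  refine ⟨{ toFun := fun a => (AddCircle.toCircle (f a) : ℂ)
            map_zero_eq_one' := by simp
            map_add_eq_mul' := fun a b => by simp [AddCircle.toCircle_add] }, ?_⟩
  intro a b h
  exact hf (AddCircle.injective_toCircle one_ne_zero (Subtype.ext h))

theorem charModule_finite_card_le (G : Type) [AddCommGroup G] [Finite G] :
    Finite (CharacterModule G) ∧ Nat.card (CharacterModule G) ≤ Nat.card G := by
  obtain ⟨c, hc⟩ := exists_addChar_injective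
  have := Fintype.ofFinite G
  let g : CharacterModule G → AddChar G ℂ := fun ψ => c.compAddMonoidHom ψ
  have hg : Function.Injective g := by
    intro a b h
    ext x
    exact hc (DFunLike.congr_fun h x)
  have : Finite (AddChar G ℂ) := inferInstance
  refine ⟨Finite.of_injective g hg, ?_⟩
  refine (Nat.card_le_card_of_injective g hg).trans ?_
  rw [Nat.card_eq_fintype_card, Nat.card_eq_fintype_card, AddChar.card_eq]

instance (G : Type) [AddCommGroup G] [Finite G] : Finite (CharacterModule G) :=
  (charModule_finite_card_le G).1

theorem charModule_card (G : Type) [AddCommGroup G] [Finite G] :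
    Nat.card (CharacterModule G) = Nat.card G := by
  refine le_antisymm (charModule_finite_card_le G).2 ?_
  refine le_trans ?_ (charModule_finite_card_le (CharacterModule G)).2
  let g : G →+ CharacterModule (CharacterModule G) :=
    { toFun := fun x =>
        { toFun := fun c => c x, map_zero' := rfl, map_add' := fun _ _ => rfl }
      map_zero' := by ext c; exact map_zero c
      map_add' := fun x y => by ext c; exact map_add c x y }
  refine Nat.card_le_card_of_injective g ?_
  rw [injective_iff_map_eq_zero]
  intro x hx
  exact CharacterModule.eq_zero_of_character_apply fun c => DFunLike.congr_fun hx c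

theorem frobenius_duality {R : Type} [CommRing R] (I : Ideal R) [Finite (R ⧸ I)] (s : R)
    (hs : s ∉ I) (hI : ∀ a : R, a ∉ I → ∃ b : R, b * a - s ∈ I)
    (F : Type) [AddCommGroup F] [Module R F] (hF : ∀ x ∈ I, ∀ y : F, x • y = 0) :
    Nonempty ((F →ₗ[R] (R ⧸ I)) ≃ₗ[R] CharacterModule F) := by
  obtain ⟨φ, hφ⟩ := CharacterModule.exists_character_apply_ne_zero_of_ne_zero
    (a := (Submodule.Quotient.mk s : R ⧸ I)) (by
      rw [Ne, Submodule.Quotient.mk_eq_zero]; exact hs)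
  have key : ∀ a : R ⧸ I, (∀ b : R, φ (b • a) = 0) → a = 0 := by
    intro a ha
    obtain ⟨a, rfl⟩ := Submodule.Quotient.mk_surjective _ a
    by_contra hne
    rw [Submodule.Quotient.mk_eq_zero] at hne
    obtain ⟨b, hb⟩ := hI a hne
    have := ha b
    rw [← Submodule.Quotient.mk_smul, smul_eq_mul, (Submodule.Quotient.eq I).mpr hb] at this
    exact hφ this
  let ι : (R ⧸ I) →ₗ[R] CharacterModule (R ⧸ I) :=
    { toFun := fun a => φ.comp (LinearMap.mulLeft R a).toAddMonoidHom
      map_add' := fun a b => by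
        ext x
        change φ ((a + b) * x) = φ (a * x) + φ (b * x)
        rw [add_mul, map_add]
      map_smul' := fun c a => by
        ext x
        change φ ((c • a) * x) = φ (a * (c • x))
        rw [smul_mul_assoc, mul_smul_comm] }
  have hι : Function.Injective ι := by
    rw [injective_iff_map_eq_zero]
    intro a ha
    refine key a fun b => ?_
    have h := DFunLike.congr_fun ha (Submodule.Quotient.mk b : R ⧸ I)
    change φ (a * (Ideal.Quotient.mk I b)) = 0 at h
    rwa [Algebra.smul_def, mul_comm]
  have hιb : Function.Bijective ι := by
    rw [Nat.bijective_iff_injective_and_card]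
    exact ⟨hι, (charModule_card _).symm⟩
  let e := LinearEquiv.ofBijective ι hιb
  let T : (F →ₗ[R] (R ⧸ I)) →ₗ[R] CharacterModule F :=
    { toFun := fun h => φ.comp h.toAddMonoidHom
      map_add' := fun a b => by
        ext x
        change φ (a x + b x) = φ (a x) + φ (b x)
        rw [map_add]
      map_smul' := fun c a => by
        ext x
        change φ (c • a x) = φ (a (c • x))
        rw [LinearMap.map_smul] }
  refine ⟨LinearEquiv.ofBijective T ⟨?_, ?_⟩⟩
  · rw [injective_iff_map_eq_zero]
    intro h hh
    ext x
    refine key _ fun b => ?_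
    rw [← map_smul]
    exact DFunLike.congr_fun hh (b • x)
  · intro ψ
    have hl : ∀ x : F, I ≤ LinearMap.ker (LinearMap.toSpanSingleton R F x) := by
      intro x a ha
      simpa using hF a ha x
    let Θ : F →ₗ[R] CharacterModule (R ⧸ I) :=
      { toFun := fun x => ψ.comp
          (Submodule.liftQ I (LinearMap.toSpanSingleton R F x) (hl x)).toAddMonoidHom
        map_add' := fun x y => by
          ext a
          obtain ⟨a, rfl⟩ := Submodule.Quotient.mk_surjective _ a
          change ψ (a • (x + y)) = ψ (a • x) + ψ (a • y)
          rw [smul_add, map_add]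
        map_smul' := fun c x => by
          ext a
          obtain ⟨a, rfl⟩ := Submodule.Quotient.mk_surjective _ a
          change ψ (a • (c • x)) = ψ ((c * a) • x)
          rw [smul_smul, mul_comm] }
    refine ⟨e.symm.toLinearMap ∘ₗ Θ, ?_⟩
    ext x
    have h1 : ι (e.symm (Θ x)) = Θ x := e.apply_symm_apply (Θ x)
    have h2 := DFunLike.congr_fun h1 (Submodule.Quotient.mk 1 : R ⧸ I)
    change φ (e.symm (Θ x) * 1) = ψ ((1 : R) • x) at h2
    rw [mul_one, one_smul] at h2
    exact h2

end Duality
section ValRing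

variable (p : ℕ) [Fact p.Prime] (K : Type) [Field K] [Algebra ℚ_[p] K]
    [Algebra ℤ_[p] K] [IsScalarTower ℤ_[p] ℚ_[p] K] [FiniteDimensional ℚ_[p] K]

theorem isIntegral_of_spectralNorm_le_one (x : K) (hx : spectralNorm ℚ_[p] K x ≤ 1) :
    IsIntegral ℤ_[p] x := by
  have hxi : IsIntegral ℚ_[p] x := Algebra.IsIntegral.isIntegral x
  have hm := minpoly.monic hxi
  have hc := (spectralValue_le_one_iff hm).mp hx
  have hl : minpoly ℚ_[p] x ∈ Polynomial.lifts (algebraMap ℤ_[p] ℚ_[p]) := by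
    rw [Polynomial.lifts_iff_coeff_lifts]
    intro n
    exact ⟨⟨_, hc n⟩, rfl⟩
  obtain ⟨q, hq, -, hqm⟩ := Polynomial.lifts_and_natDegree_eq_and_monic hl hm
  refine ⟨q, hqm, ?_⟩
  have := minpoly.aeval ℚ_[p] x
  rw [← hq, Polynomial.aeval_map_algebraMap] at this
  exact this

theorem isIntegral_or_inv (x : K) : IsIntegral ℤ_[p] x ∨ IsIntegral ℤ_[p] x⁻¹ := by
  by_cases h : spectralNorm ℚ_[p] K x ≤ 1
  · exact Or.inl (isIntegral_of_spectralNorm_le_one p K x h)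
  · right
    apply isIntegral_of_spectralNorm_le_one
    push Not at h
    have hx : x ≠ 0 := by
      rintro rfl
      rw [spectralNorm_zero] at h
      linarith
    have h1 := spectralAlgNorm_mul (K := ℚ_[p]) x x⁻¹
    rw [mul_inv_cancel₀ hx, spectralAlgNorm_one, spectralAlgNorm_def, spectralAlgNorm_def] at h1
    have h2 : 0 ≤ spectralNorm ℚ_[p] K x⁻¹ := spectralNorm_nonneg _
    nlinarith

instance padicValRing_isFractionRing : IsFractionRing (PadicValRing p K) K :=
  integralClosure.isFractionRing_of_finite_extension ℚ_[p] K

instance padicValRing_finite : Module.Finite ℤ_[p] (PadicValRing p K) :=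
  IsIntegralClosure.finite ℤ_[p] ℚ_[p] K (PadicValRing p K)

instance padicValRing_noeth : IsNoetherianRing (PadicValRing p K) :=
  IsNoetherianRing.of_finite ℤ_[p] (PadicValRing p K)

instance padicValRing_valuationRing : ValuationRing (PadicValRing p K) := by
  rw [ValuationRing.iff_isInteger_or_isInteger _ K]
  intro x
  rcases isIntegral_or_inv p K x with h | h
  · exact Or.inl ⟨⟨x, h⟩, rfl⟩
  · exact Or.inr ⟨⟨x⁻¹, h⟩, rfl⟩

theorem padicValRing_injective : Function.Injective (algebraMap ℤ_[p] (PadicValRing p K)) := by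
  have h : Function.Injective (algebraMap ℤ_[p] K) := by
    rw [IsScalarTower.algebraMap_eq ℤ_[p] ℚ_[p] K]
    exact (algebraMap ℚ_[p] K).injective.comp (IsFractionRing.injective ℤ_[p] ℚ_[p])
  rw [IsScalarTower.algebraMap_eq ℤ_[p] (PadicValRing p K) K] at h
  rw [RingHom.coe_comp] at h
  exact Function.Injective.of_comp h

instance padicValRing_localHom : IsLocalHom (algebraMap ℤ_[p] (PadicValRing p K)) :=
  (algebraMap_isIntegral_iff.mpr inferInstance).isLocalHom (padicValRing_injective p K)

instance padicValRing_residue_finite :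
    Finite (IsLocalRing.ResidueField (PadicValRing p K)) := by
  have h : Finite (IsLocalRing.ResidueField ℤ_[p]) :=
    Finite.of_equiv _ (PadicInt.residueField (p := p)).symm.toEquiv
  exact IsLocalRing.ResidueField.finite_of_finite h

instance padicValRing_dvr : IsDiscreteValuationRing (PadicValRing p K) where
  not_a_field' := by
    intro h
    have h1 : algebraMap ℤ_[p] (PadicValRing p K) p ∈
        IsLocalRing.maximalIdeal (PadicValRing p K) := by
      rw [IsLocalRing.mem_maximalIdeal, mem_nonunits_iff]
      intro h2
      have h3 := isUnit_of_map_unit _ _ h2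
      exact PadicInt.prime_p.not_isUnit h3
    rw [h, Ideal.mem_bot] at h1
    have h2 := padicValRing_injective p K (h1.trans (map_zero _).symm)
    exact PadicInt.prime_p.ne_zero h2

end ValRing
section PowerSeries

open MvPowerSeries

theorem isSMulRegular_quot {R : Type} [CommRing R] (I : Ideal R) (x : R)
    (h : ∀ f, x * f ∈ I → f ∈ I) : IsSMulRegular (R ⧸ (I • ⊤ : Submodule R R)) x := by
  have hI : (I • ⊤ : Submodule R R) = I := by
    rw [smul_eq_mul, Ideal.mul_top]
  rw [hI, isSMulRegular_iff_right_eq_zero_of_smul]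
  intro a ha
  obtain ⟨a, rfl⟩ := Submodule.Quotient.mk_surjective _ a
  rw [← Submodule.Quotient.mk_smul, Submodule.Quotient.mk_eq_zero] at ha
  rw [Submodule.Quotient.mk_eq_zero]
  exact h a ha

variable {O : Type} [CommRing O] {r : ℕ}

/-- the ideal of series whose coefficients in the box are divisible by `c` -/
def boxIdeal (j : ℕ) (l : List (Fin r)) (c : O) : Ideal (MvPowerSeries (Fin r) O) where
  carrier := {f | ∀ α : Fin r →₀ ℕ, (∀ i ∈ l, α i < j) → c ∣ coeff α f}
  add_mem' := fun {a b} ha hb α hα => by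
    rw [map_add]
    exact dvd_add (ha α hα) (hb α hα)
  zero_mem' := fun α _ => by simp
  smul_mem' := fun g f hf α hα => by
    rw [smul_eq_mul, coeff_mul]
    refine Finset.dvd_sum fun x hx => Dvd.dvd.mul_left (hf _ fun i hi => ?_) _
    rw [Finset.HasAntidiagonal.mem_antidiagonal] at hx
    have h1 := hα i hi
    rw [← hx, Finsupp.add_apply] at h1
    omega

theorem mem_boxIdeal {j : ℕ} {l : List (Fin r)} {c : O} {f : MvPowerSeries (Fin r) O} :
    f ∈ boxIdeal j l c ↔ ∀ α : Fin r →₀ ℕ, (∀ i ∈ l, α i < j) → c ∣ coeff α f := Iff.rfl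

/-- the powers of the variables in a list -/
def varList (O : Type) [CommRing O] {r : ℕ} (j : ℕ) (l : List (Fin r)) :
    List (MvPowerSeries (Fin r) O) :=
  l.map (fun i => (X i : MvPowerSeries (Fin r) O) ^ j)

theorem ofList_varList (j : ℕ) (l : List (Fin r)) :
    Ideal.ofList (varList O j l) = boxIdeal j l 0 := by
  classical
  apply le_antisymm
  · refine Ideal.span_le.mpr ?_
    intro f hf
    obtain ⟨i, hi, rfl⟩ := List.mem_map.mp hf
    intro α hα
    exact zero_dvd_iff.mpr (X_pow_dvd_iff.mp dvd_rfl α (hα i hi))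
  · induction l with
    | nil =>
      intro f hf
      have : f = 0 := by
        ext α
        exact zero_dvd_iff.mp (hf α (by simp))
      rw [this]
      exact zero_mem _
    | cons i l ih =>
      intro f hf
      let f2 : MvPowerSeries (Fin r) O := fun α => if α i < j then coeff α f else 0
      have hc : ∀ α, coeff α f2 = if α i < j then coeff α f else 0 := fun α => rfl
      have h1 : X i ^ j ∣ f - f2 := by
        rw [X_pow_dvd_iff]
        intro α hα
        rw [map_sub, hc, if_pos hα, sub_self]
      have h2 : f2 ∈ boxIdeal j l (0 : O) := by
        intro α hα
        rw [hc]
        split_ifs with h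
        · exact hf α (by
            intro k hk
            rcases List.mem_cons.mp hk with rfl | hk
            · exact h
            · exact hα k hk)
        · exact dvd_rfl
      have h3 : varList O j (i :: l) = X i ^ j :: varList O j l := rfl
      rw [h3, Ideal.ofList_cons, ← sub_add_cancel f f2]
      exact Submodule.add_mem_sup (Ideal.mem_span_singleton.mpr h1) (ih h2)

theorem ofList_full (j : ℕ) (l : List (Fin r)) (c : O) :
    Ideal.ofList (varList O j l ++ [C c]) = boxIdeal j l c := by
  classical
  rw [Ideal.ofList_append, Ideal.ofList_singleton, ofList_varList]
  apply le_antisymm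
  · refine sup_le ?_ ?_
    · intro f hf α hα
      rw [zero_dvd_iff.mp (hf α hα)]
      exact dvd_zero _
    · rw [Ideal.span_singleton_le_iff_mem]
      intro α _
      rw [coeff_C]
      split_ifs
      · exact dvd_rfl
      · exact dvd_zero _
  · intro f hf
    choose! g hg using hf
    let f2 : MvPowerSeries (Fin r) O := g
    have h1 : f - C c * f2 ∈ boxIdeal j l (0 : O) := by
      intro α hα
      rw [map_sub, coeff_C_mul, hg α hα]
      exact zero_dvd_iff.mpr (sub_self _)
    rw [← sub_add_cancel f (C c * f2)]
    exact Submodule.add_mem_sup h1 (Ideal.mul_mem_right _ _ (Ideal.mem_span_singleton_self _))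

theorem varList_regular (j : ℕ) (l : List (Fin r)) (hl : l.Nodup) :
    RingTheory.Sequence.IsWeaklyRegular (MvPowerSeries (Fin r) O) (varList O j l) := by
  classical
  induction l using List.reverseRecOn with
  | nil => exact RingTheory.Sequence.IsWeaklyRegular.nil _ _
  | append_singleton l i ih =>
    have h3 : varList O j (l ++ [i]) = varList O j l ++ [X i ^ j] := by
      simp [varList]
    rw [List.nodup_append] at hl
    rw [h3, RingTheory.Sequence.isWeaklyRegular_append_iff,
      RingTheory.Sequence.isWeaklyRegular_singleton_iff]
    refine ⟨ih hl.1, isSMulRegular_quot _ _ ?_⟩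
    rw [ofList_varList]
    intro f hf α hα
    have h := hf (Finsupp.single i j + α) (by
      intro k hk
      have : i ≠ k := fun h => hl.2.2 k hk i (by simp) h.symm
      rw [Finsupp.add_apply, Finsupp.single_apply, if_neg this, zero_add]
      exact hα k hk)
    rwa [X_pow_eq, coeff_add_monomial_mul, one_mul] at h

theorem fullList_regular [IsDomain O] (j : ℕ) (l : List (Fin r)) (hl : l.Nodup) (c : O)
    (hc : c ≠ 0) : RingTheory.Sequence.IsWeaklyRegular (MvPowerSeries (Fin r) O)
      (varList O j l ++ [C c]) := by
  rw [RingTheory.Sequence.isWeaklyRegular_append_iff,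
      RingTheory.Sequence.isWeaklyRegular_singleton_iff]
  refine ⟨varList_regular j l hl, isSMulRegular_quot _ _ ?_⟩
  rw [ofList_varList]
  intro f hf α hα
  have h := hf α hα
  rw [coeff_C_mul, zero_dvd_iff] at h
  exact zero_dvd_iff.mpr ((mul_eq_zero.mp h).resolve_left hc)

variable [IsDomain O] [IsDiscreteValuationRing O] {π : O}

theorem maximalIdeal_eq_box (hπ : Irreducible π) :
    IsLocalRing.maximalIdeal (MvPowerSeries (Fin r) O) =
      boxIdeal 1 (List.finRange r) (π ^ 1) := by
  ext f
  rw [IsLocalRing.mem_maximalIdeal, mem_nonunits_iff, isUnit_iff_constantCoeff,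
    ← mem_nonunits_iff, ← IsLocalRing.mem_maximalIdeal, hπ.maximalIdeal_eq,
    Ideal.mem_span_singleton, mem_boxIdeal, pow_one]
  constructor
  · intro h α hα
    have : α = 0 := by
      ext i
      simpa using hα i (List.mem_finRange i)
    rw [this, coeff_zero_eq_constantCoeff_apply]
    exact h
  · intro h
    have := h 0 (by simp)
    rwa [coeff_zero_eq_constantCoeff_apply] at this

theorem box_socle (hπ : Irreducible π) (j : ℕ) (hj : 1 ≤ j) :
    ∃ s : MvPowerSeries (Fin r) O, s ∉ boxIdeal j (List.finRange r) (π ^ j) ∧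
      ∀ a, a ∉ boxIdeal j (List.finRange r) (π ^ j) →
        ∃ b, b * a - s ∈ boxIdeal j (List.finRange r) (π ^ j) := by
  classical
  obtain ⟨k, rfl⟩ : ∃ k, j = k + 1 := ⟨j - 1, by omega⟩
  let δ : Fin r →₀ ℕ := Finsupp.equivFunOnFinite.symm (fun _ => k)
  have hδ : ∀ i, δ i = k := fun i => rfl
  refine ⟨monomial δ (π ^ k), ?_, ?_⟩
  · intro h
    have := h δ (fun i _ => by rw [hδ]; omega)
    rw [coeff_monomial_same, pow_dvd_pow_iff hπ.ne_zero hπ.not_isUnit] at this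
    omega
  · intro a ha
    rw [mem_boxIdeal] at ha
    push Not at ha
    let S : Set (Fin r →₀ ℕ) := {α | (∀ i ∈ List.finRange r, α i < k + 1) ∧
      ¬ π ^ (k + 1) ∣ coeff α a}
    have hS : S.Nonempty := ha
    obtain ⟨α, ⟨hα1, hα2⟩, hmin⟩ := WellFounded.has_min (wellFounded_lt (α := Fin r →₀ ℕ)) S hS
    have hne : coeff α a ≠ 0 := by
      intro h
      rw [h] at hα2
      exact hα2 (dvd_zero _)
    obtain ⟨v, u, hu⟩ := IsDiscreteValuationRing.eq_unit_mul_pow_irreducible hne hπ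
    have hv : v ≤ k := by
      by_contra hv
      apply hα2
      rw [hu]
      exact Dvd.dvd.mul_left (pow_dvd_pow _ (by omega)) _
    have hαk : ∀ i, α i ≤ k := fun i => Nat.lt_succ_iff.mp (hα1 i (List.mem_finRange i))
    refine ⟨monomial (δ - α) (π ^ (k - v) * (↑u⁻¹ : O)), ?_⟩
    intro β hβ
    have hβk : ∀ i, β i ≤ k := fun i => Nat.lt_succ_iff.mp (hβ i (List.mem_finRange i))
    rw [map_sub, coeff_monomial_mul, coeff_monomial]
    by_cases hβδ : β = δ
    · rw [hβδ]
      have h1 : δ - (δ - α) = α := by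
        ext i
        have := hαk i
        have := hδ i
        simp only [Finsupp.tsub_apply]
        omega
      rw [if_pos tsub_le_self, if_pos rfl, h1, hu]
      have : π ^ (k - v) * (↑u⁻¹ : O) * (↑u * π ^ v) = π ^ k := by
        calc π ^ (k - v) * (↑u⁻¹ : O) * (↑u * π ^ v)
            = (π ^ (k - v) * π ^ v) * ((↑u⁻¹ : O) * ↑u) := by ring
          _ = π ^ k := by rw [← pow_add, Nat.sub_add_cancel hv, Units.inv_mul, mul_one]
      rw [this, sub_self]
      exact dvd_zero _
    · rw [if_neg hβδ, sub_zero]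
      split_ifs with hle
      · apply Dvd.dvd.mul_left
        by_contra hnd
        refine hmin (β - (δ - α)) ⟨fun i hi => ?_, hnd⟩ ?_
        · have := hβk i
          simp only [Finsupp.tsub_apply]
          omega
        · refine lt_of_le_of_ne ?_ ?_
          · intro i
            have := hαk i
            have := hβk i
            have := hδ i
            simp only [Finsupp.tsub_apply]
            omega
          · intro heq
            apply hβδ
            ext i
            have h1 := DFunLike.congr_fun heq i
            have h2 := hle i
            have := hαk i
            have := hδ i
            simp only [Finsupp.tsub_apply] at h1 h2
            omega
      · exact dvd_zero _

theorem residue_finite [Finite (IsLocalRing.ResidueField O)] :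
    Finite (MvPowerSeries (Fin r) O ⧸ IsLocalRing.maximalIdeal (MvPowerSeries (Fin r) O)) := by
  let g : MvPowerSeries (Fin r) O →+* IsLocalRing.ResidueField O :=
    (IsLocalRing.residue O).comp constantCoeff
  have hg : RingHom.ker g = IsLocalRing.maximalIdeal (MvPowerSeries (Fin r) O) := by
    ext f
    rw [IsLocalRing.mem_maximalIdeal, mem_nonunits_iff, isUnit_iff_constantCoeff,
      ← mem_nonunits_iff, ← IsLocalRing.mem_maximalIdeal, RingHom.mem_ker]
    exact IsLocalRing.residue_eq_zero_iff _
  rw [← hg]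
  exact Finite.of_injective _ (RingHom.kerLift_injective g)

theorem box_quot_finite [Finite (IsLocalRing.ResidueField O)] (hπ : Irreducible π) (j : ℕ) :
    Finite (MvPowerSeries (Fin r) O ⧸ boxIdeal j (List.finRange r) (π ^ j)) := by
  have hfg : (IsLocalRing.maximalIdeal (MvPowerSeries (Fin r) O)).FG :=
    (isNoetherianRing_iff_ideal_fg _).mp inferInstance _
  have hrad : IsLocalRing.maximalIdeal (MvPowerSeries (Fin r) O) ≤
      (boxIdeal j (List.finRange r) (π ^ j)).radical := by
    rw [maximalIdeal_eq_box hπ, ← ofList_full, ← ofList_full]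
    refine Ideal.span_le.mpr ?_
    intro f hf
    rcases List.mem_append.mp hf with hf | hf
    · obtain ⟨i, hi, rfl⟩ := List.mem_map.mp hf
      refine ⟨j, Ideal.subset_span ?_⟩
      simp only [pow_one]
      exact List.mem_append_left _ (List.mem_map.mpr ⟨i, hi, rfl⟩)
    · rw [List.mem_singleton.mp hf]
      refine ⟨j, Ideal.subset_span ?_⟩
      rw [pow_one, ← map_pow]
      exact List.mem_append_right _ (by simp)
  obtain ⟨k, hk⟩ := Ideal.exists_pow_le_of_le_radical_of_fg hrad hfg
  have := residue_finite (O := O) (r := r)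
  have := Ideal.finite_quotient_pow hfg k
  exact Finite.of_surjective _ (Ideal.Quotient.factor_surjective hk)

end PowerSeries
section FinPart

variable {R : Type} [CommRing R]

theorem finPart_finite [IsNoetherianRing R] (M : Type) [AddCommGroup M] [Module R M]
    [Module.Finite R M] : Set.Finite (finPart R M : Set M) := by
  have : IsNoetherian R M := isNoetherian_of_isNoetherianRing_of_finite R M
  obtain ⟨N, hN, hmax⟩ := WellFounded.has_min (wellFounded_gt (α := Submodule R M))
    {N : Submodule R M | Set.Finite (N : Set M)} ⟨⊥, by simp⟩
  have : finPart R M = N := by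
    refine le_antisymm (sSup_le fun P hP => ?_) (le_sSup hN)
    by_contra hle
    refine hmax (P ⊔ N) ?_ ?_
    · change Set.Finite ((P ⊔ N : Submodule R M) : Set M)
      rw [Submodule.coe_sup]
      exact Set.Finite.add hP hN
    · exact lt_of_le_of_ne le_sup_right fun h => hle (h ▸ le_sup_left)
  rw [this]
  exact hN

theorem hom_quot_finPart [IsNoetherianRing R] (M : Type) [AddCommGroup M] [Module R M]
    [Module.Finite R M] (k : Type) [AddCommGroup k] [Module R k] [Finite k] :
    Subsingleton (k →ₗ[R] M ⧸ finPart R M) := by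
  suffices h : ∀ f : k →ₗ[R] M ⧸ finPart R M, f = 0 from ⟨fun a b => by rw [h a, h b]⟩
  intro f
  let P : Submodule R M := (LinearMap.range f).comap (finPart R M).mkQ
  have hP : Set.Finite (P : Set M) := by
    have h1 : Set.Finite ((LinearMap.range f : Submodule R _) : Set (M ⧸ finPart R M)) := by
      rw [LinearMap.coe_range]
      exact Set.finite_range f
    change Set.Finite (Set.preimage (finPart R M).mkQ ((LinearMap.range f : Submodule R _) :
      Set (M ⧸ finPart R M)))
    refine Set.Finite.preimage' h1 fun b _ => ?_
    obtain ⟨x, rfl⟩ := Submodule.Quotient.mk_surjective _ b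
    refine Set.Finite.subset ((finPart_finite (R := R) M).image (fun n => n + x)) ?_
    intro y hy
    have hy' : (Submodule.Quotient.mk y : M ⧸ finPart R M) = Submodule.Quotient.mk x := hy
    rw [Submodule.Quotient.eq] at hy'
    exact ⟨y - x, hy', by simp⟩
  have hle : P ≤ finPart R M := le_sSup hP
  ext x
  obtain ⟨y, hy⟩ := Submodule.Quotient.mk_surjective _ (f x)
  have : y ∈ P := ⟨x, hy.symm⟩
  rw [← hy, LinearMap.zero_apply, Submodule.Quotient.mk_eq_zero]
  exact hle this

theorem nilpotent_on_finite [IsLocalRing R] (F : Type) [AddCommGroup F] [Module R F] [Finite F]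
    (x : R) (hx : x ∈ IsLocalRing.maximalIdeal R) :
    ∃ a : ℕ, ∀ j, a ≤ j → ∀ y : F, x ^ j • y = 0 := by
  obtain ⟨a, b, hab, h⟩ := Finite.exists_ne_map_eq_of_infinite
    (fun (n : ℕ) (y : F) => x ^ n • y)
  wlog hlt : a < b generalizing a b
  · exact this b a hab.symm h.symm (by omega)
  refine ⟨a, fun j hj y => ?_⟩
  have h1 : x ^ a • y = x ^ b • y := congrFun h y
  have h2 : (1 - x ^ (b - a)) • (x ^ a • y) = 0 := by
    rw [sub_smul, one_smul, smul_smul, ← pow_add, Nat.sub_add_cancel hlt.le, h1, sub_self]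
  have h3 : IsUnit (1 - x ^ (b - a)) := by
    apply IsLocalRing.isUnit_one_sub_self_of_mem_nonunits
    rw [← IsLocalRing.mem_maximalIdeal]
    exact Ideal.pow_mem_of_mem _ hx _ (by omega)
  have h4 : x ^ a • y = 0 := (IsUnit.smul_eq_zero h3).mp h2
  rw [← Nat.sub_add_cancel hj, pow_add, mul_smul, h4, smul_zero]

end FinPart

section Main

open MvPowerSeries

variable {O : Type} [CommRing O] [IsDomain O] [IsDiscreteValuationRing O]
  [Finite (IsLocalRing.ResidueField O)] (r : ℕ)

theorem residue_ext_vanish (i : ℕ) (hi : r + 1 < i) :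
    Subsingleton (Abelian.Ext (ModuleCat.of (MvPowerSeries (Fin r) O)
      (MvPowerSeries (Fin r) O ⧸ IsLocalRing.maximalIdeal (MvPowerSeries (Fin r) O)))
      (ModuleCat.of (MvPowerSeries (Fin r) O) (MvPowerSeries (Fin r) O)) i) := by
  obtain ⟨π, hπ⟩ := IsDiscreteValuationRing.exists_irreducible O
  let rs := varList O 1 (List.finRange r) ++ [C (π ^ 1)]
  have hreg : RingTheory.Sequence.IsWeaklyRegular (MvPowerSeries (Fin r) O) rs :=
    fullList_regular 1 _ (List.nodup_finRange r) _ (pow_ne_zero _ hπ.ne_zero)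
  have hof : Ideal.ofList rs = IsLocalRing.maximalIdeal (MvPowerSeries (Fin r) O) := by
    rw [ofList_full, maximalIdeal_eq_box hπ]
  have hlen : rs.length = r + 1 := by simp [rs, varList]
  have hpd := ModuleCat.projectiveDimension_quotient_eq_add_length_of_isWeaklyRegular
    (ModuleCat.of (MvPowerSeries (Fin r) O) (MvPowerSeries (Fin r) O)) rs hreg
    (fun x hx => hof ▸ Ideal.subset_span hx)
  have hpd0 : projectiveDimension (ModuleCat.of (MvPowerSeries (Fin r) O)
      (MvPowerSeries (Fin r) O)) = 0 := ModuleCat.projectiveDimension_eq_zero_of_projective _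
  rw [hpd0, zero_add, hlen] at hpd
  have heq : (Ideal.ofList rs • ⊤ : Submodule (MvPowerSeries (Fin r) O)
      (MvPowerSeries (Fin r) O)) = IsLocalRing.maximalIdeal (MvPowerSeries (Fin r) O) := by
    rw [smul_eq_mul, Ideal.mul_top, hof]
  have hpd2 : projectiveDimension (ModuleCat.of (MvPowerSeries (Fin r) O)
      (MvPowerSeries (Fin r) O ⧸ IsLocalRing.maximalIdeal (MvPowerSeries (Fin r) O))) =
      ((r + 1 : ℕ) : WithBot ℕ∞) := by
    rw [← hpd]
    exact projectiveDimension_eq_of_iso (Submodule.quotEquivOfEq _ _ heq.symm).toModuleIso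
  have hlt : HasProjectiveDimensionLT (ModuleCat.of (MvPowerSeries (Fin r) O)
      (MvPowerSeries (Fin r) O ⧸ IsLocalRing.maximalIdeal (MvPowerSeries (Fin r) O))) i := by
    rw [← projectiveDimension_lt_iff, hpd2]
    exact_mod_cast hi
  exact HasProjectiveDimensionLT.subsingleton _ i i le_rfl _

theorem ext_finite_equiv (F : Type) [AddCommGroup F] [Module (MvPowerSeries (Fin r) O) F]
    [Finite F] :
    Nonempty (Abelian.Ext (ModuleCat.of (MvPowerSeries (Fin r) O) F)
      (ModuleCat.of (MvPowerSeries (Fin r) O) (MvPowerSeries (Fin r) O)) (r + 1)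
      ≃ₗ[MvPowerSeries (Fin r) O] CharacterModule F) := by
  obtain ⟨π, hπ⟩ := IsDiscreteValuationRing.exists_irreducible O
  have hmem : ∀ x ∈ varList O 1 (List.finRange r) ++ [C (π ^ 1)],
      x ∈ IsLocalRing.maximalIdeal (MvPowerSeries (Fin r) O) := by
    intro x hx
    rw [maximalIdeal_eq_box hπ, ← ofList_full]
    exact Ideal.subset_span hx
  have hX : ∀ i : Fin r, ∃ a : ℕ, ∀ j, a ≤ j → ∀ y : F,
      (X i : MvPowerSeries (Fin r) O) ^ j • y = 0 := fun i =>
    nilpotent_on_finite F _ (hmem _ (by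
      refine List.mem_append_left _ (List.mem_map.mpr ⟨i, List.mem_finRange i, pow_one _⟩)))
  choose a ha using hX
  obtain ⟨b, hb⟩ := nilpotent_on_finite F (C π : MvPowerSeries (Fin r) O)
    (hmem _ (by simp))
  obtain ⟨j, hj1, hjb, hja⟩ : ∃ j, 1 ≤ j ∧ b ≤ j ∧ ∀ i, a i ≤ j :=
    ⟨∑ i, a i + b + 1, by omega, by omega, fun i => by
      have := Finset.single_le_sum (f := a) (fun _ _ => Nat.zero_le _) (Finset.mem_univ i)
      omega⟩
  let rs := varList O j (List.finRange r) ++ [C (π ^ j)]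
  have hreg : RingTheory.Sequence.IsWeaklyRegular (MvPowerSeries (Fin r) O) rs :=
    fullList_regular j _ (List.nodup_finRange r) _ (pow_ne_zero _ hπ.ne_zero)
  have hof : Ideal.ofList rs = boxIdeal j (List.finRange r) (π ^ j) := ofList_full _ _ _
  have hlen : rs.length = r + 1 := by simp [rs, varList]
  have hkill : ∀ x ∈ rs, ∀ y : F, x • y = 0 := by
    intro x hx y
    rcases List.mem_append.mp hx with hx | hx
    · obtain ⟨i, -, rfl⟩ := List.mem_map.mp hx
      exact ha i j (hja i) y
    · rw [List.mem_singleton.mp hx, map_pow]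
      exact hb j hjb y
  have hkill2 : ∀ x ∈ boxIdeal j (List.finRange r) (π ^ j), ∀ y : F, x • y = 0 := by
    intro x hx y
    have hle : Ideal.ofList rs ≤ Module.annihilator (MvPowerSeries (Fin r) O) F :=
      Ideal.span_le.mpr fun z hz => Module.mem_annihilator.mpr (hkill z hz)
    rw [← hof] at hx
    exact Module.mem_annihilator.mp (hle hx) y
  obtain ⟨s, hs, hs2⟩ := box_socle (r := r) hπ j hj1
  have := box_quot_finite (r := r) hπ j
  obtain ⟨e2⟩ := frobenius_duality _ s hs hs2 F hkill2
  obtain ⟨e1⟩ := (rees F rs _ hreg hkill).2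
  rw [hlen] at e1
  have heq : (Ideal.ofList rs • ⊤ : Submodule (MvPowerSeries (Fin r) O)
      (MvPowerSeries (Fin r) O)) = boxIdeal j (List.finRange r) (π ^ j) := by
    rw [smul_eq_mul, Ideal.mul_top, hof]
  exact ⟨e1 ≪≫ₗ LinearEquiv.congrRight (Submodule.quotEquivOfEq _ _ heq) ≪≫ₗ e2⟩

theorem main_equiv (M : Type) [AddCommGroup M] [Module (MvPowerSeries (Fin r) O) M]
    [Module.Finite (MvPowerSeries (Fin r) O) M] :
    Nonempty (ExtGroup (MvPowerSeries (Fin r) O) (r + 1) M (MvPowerSeries (Fin r) O)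
      ≃ₗ[MvPowerSeries (Fin r) O] CharacterModule (finPart (MvPowerSeries (Fin r) O) M)) := by
  obtain ⟨e1⟩ := extComparison (ModuleCat.of (MvPowerSeries (Fin r) O) M)
    (ModuleCat.of (MvPowerSeries (Fin r) O) (MvPowerSeries (Fin r) O)) r
  have := residue_finite (O := O) (r := r)
  obtain ⟨e2⟩ := ext_equiv_sub
    (ModuleCat.of (MvPowerSeries (Fin r) O) (MvPowerSeries (Fin r) O)) (r + 1)
    (residue_ext_vanish r) M (finPart (MvPowerSeries (Fin r) O) M)
    (hom_quot_finPart M _)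
  have : Finite (finPart (MvPowerSeries (Fin r) O) M) := (finPart_finite M).to_subtype
  obtain ⟨e3⟩ := ext_finite_equiv (O := O) r (finPart (MvPowerSeries (Fin r) O) M)
  exact ⟨e1 ≪≫ₗ e2 ≪≫ₗ e3⟩

end Main

/-- For a small `Λ`-module `M`, the group `Ext^{r+1}_Λ(M,Λ)` is finite
and is isomorphic, as an `O`-module (in particular as an abelian group), to the
Pontryagin dual `Hom_ℤ(M_fin, ℚ/ℤ)` of the maximal finite submodule `M_fin` of `M`;
in particular `Ext^{r+1}_Λ(M,Λ)` and `M_fin` have the same cardinality. -/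
theorem statement9 (p : ℕ) [Fact p.Prime] (K : Type) [Field K] [Algebra ℚ_[p] K]
    [Algebra ℤ_[p] K] [IsScalarTower ℤ_[p] ℚ_[p] K] [FiniteDimensional ℚ_[p] K]
    (r : ℕ) (hr : 1 ≤ r) (M : Type) [AddCommGroup M] [Module (IwasawaAlgebra p K r) M]
    [Module.Finite (IwasawaAlgebra p K r) M]
    (hsmall : (r : ℕ∞) ≤ idealHeight (Module.annihilator (IwasawaAlgebra p K r) M)) :
    Finite (ExtGroup (IwasawaAlgebra p K r) (r + 1) M (IwasawaAlgebra p K r)) ∧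
    (∃ e : (ExtGroup (IwasawaAlgebra p K r) (r + 1) M (IwasawaAlgebra p K r)) ≃+
        CharacterModule ↥(finPart (IwasawaAlgebra p K r) M),
      ∀ (a : PadicValRing p K)
        (x : ExtGroup (IwasawaAlgebra p K r) (r + 1) M (IwasawaAlgebra p K r)),
        e ((algebraMap (PadicValRing p K) (IwasawaAlgebra p K r) a) • x) =
          (algebraMap (PadicValRing p K) (IwasawaAlgebra p K r) a) • e x) ∧
    Nat.card (ExtGroup (IwasawaAlgebra p K r) (r + 1) M (IwasawaAlgebra p K r)) =
      Nat.card ↥(finPart (IwasawaAlgebra p K r) M) := by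
  obtain ⟨e⟩ := main_equiv (O := PadicValRing p K) r M
  have hfin : Finite (finPart (IwasawaAlgebra p K r) M) := (finPart_finite M).to_subtype
  refine ⟨Finite.of_equiv _ e.symm.toEquiv, ⟨e.toAddEquiv, fun a x => e.map_smul _ x⟩, ?_⟩
  rw [Nat.card_congr e.toEquiv, charModule_card]
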